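/- Let m₁, m₂ > 0 and σ₁, σ₂ > 0 satisfy the well-separability conditions 2σ₁² + σ₁ ≤ m₁ and 2σ₂² + σ₂ ≤ m₂. If m₁² + σ₁² = m₂² + σ₂² and ∫ y·tanh(y) d(gaussianReal m₁ σ₁²)(y) = ∫ y·tanh(y) d(gaussianReal m₂ σ₂²)(y), then m₁ = m₂ and σ₁ = σ₂. -/

import Mathlib

open MeasureTheory ProbabilityTheory

theorem eq_zero_of_nonneg_of_integral_eq_zero {h : ℝ → ℝ} (hc : Continuous h) (hi : Integrable h)
    (h0 : ∀ y, 0 ≤ h y) (hz : ∫ y, h y = 0) : h = 0 :=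
  (hc.ae_eq_iff_eq volume continuous_zero).1 ((integral_eq_zero_iff_of_nonneg h0 hi).1 hz)

theorem mul_secant_nonneg {φ g : ℝ → ℝ} {s : Set ℝ} (hφ : ConcaveOn ℝ s φ)
    (hg : StrictConcaveOn ℝ s g) {A B : ℝ} (hAs : A ∈ s) (hBs : B ∈ s) (hAB : A < B)
    (hA : 0 ≤ φ A) (hB : 0 ≤ φ B) (hS : ∀ u ∈ s, 0 ≤ φ u → A ≤ u ∧ u ≤ B) {u : ℝ} (hu : u ∈ s) :
    (u < A ∨ B < u → φ u < 0 ∧ g u - (g A + (g B - g A) / (B - A) * (u - A)) < 0) ∧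
    (A ≤ u ∧ u ≤ B → 0 ≤ φ u ∧ 0 ≤ g u - (g A + (g B - g A) / (B - A) * (u - A))) := by
  have hBA : 0 < B - A := sub_pos.2 hAB
  set k := (g B - g A) / (B - A) with hk
  have hgB : g B = g A + k * (B - A) := by rw [hk]; field_simp; ring
  refine ⟨fun h => ⟨?_, ?_⟩, fun h => ⟨?_, ?_⟩⟩
  · by_contra! hn
    have := hS u hu hn
    rcases h with h | h <;> linarith
  · rcases h with h | h
    · have := hg.slope_anti_adjacent hu hBs h hAB
      rw [← hk, lt_div_iff₀ (by linarith)] at this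
      linarith
    · have := hg.slope_anti_adjacent hAs hu hAB h
      rw [← hk, div_lt_iff₀ (by linarith)] at this
      linarith
  · have := hφ.ge_on_segment hAs hBs (z := u) (by rw [segment_eq_Icc hAB.le]; exact h)
    exact (le_min hA hB).trans this
  · rcases h.1.eq_or_lt with rfl | h1
    · simp
    rcases h.2.eq_or_lt with rfl | h2
    · linarith
    have := hg.slope_anti_adjacent hAs hBs h1 h2
    rw [div_lt_div_iff₀ (by linarith) (by linarith), hgB] at this
    nlinarith

theorem integral_pos_of_sign {D φ g : ℝ → ℝ} {R : ℝ} (hD : Continuous D)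
    (hφ : ConcaveOn ℝ (Set.Ici 0) φ) (hφc : ContinuousOn φ (Set.Ici 0))
    (hR : 0 ≤ R) (hφR : ∀ u, R < u → φ u < 0)
    (hpos : ∀ y, 0 < φ (y ^ 2) → 0 < D y) (hneg : ∀ y, φ (y ^ 2) < 0 → D y < 0)
    (hzero : ∀ y, φ (y ^ 2) = 0 → D y = 0)
    (hg : StrictConcaveOn ℝ (Set.Ici 0) g) (hgc : Continuous fun y => g (y ^ 2))
    (hiD : Integrable D) (hi2 : Integrable fun y => D y * y ^ 2)
    (hig : Integrable fun y => D y * g (y ^ 2))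
    (h0 : ∫ y, D y = 0) (h2 : ∫ y, D y * y ^ 2 = 0) :
    0 < ∫ y, D y * g (y ^ 2) := by
  have hlarge : ∀ C, ∃ y : ℝ, C < y ^ 2 ∧ R < y ^ 2 := fun C =>
    ⟨|C| + R + 1, by nlinarith [abs_nonneg C, le_abs_self C], by nlinarith [abs_nonneg C]⟩
  by_cases hex : ∃ u₀, 0 ≤ u₀ ∧ 0 < φ u₀
  · obtain ⟨u₀, hu₀, hφ₀⟩ := hex
    obtain ⟨u₁, hu₁, hφ₁⟩ : ∃ u₁, u₀ < u₁ ∧ 0 < φ u₁ := by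
      have h1 : ∀ᶠ u in nhdsWithin u₀ (Set.Ioi u₀), 0 < φ u :=
        ((hφc u₀ hu₀).mono_left (nhdsWithin_mono _ fun u hu => hu₀.trans (le_of_lt hu))).eventually
          (lt_mem_nhds hφ₀)
      obtain ⟨u, h, h'⟩ := (h1.and self_mem_nhdsWithin).exists
      exact ⟨u, h', h⟩
    set S := Set.Ici (0 : ℝ) ∩ φ ⁻¹' Set.Ici 0 with hSdef
    have hSc : IsClosed S := hφc.preimage_isClosed_of_isClosed isClosed_Ici isClosed_Ici
    have h0S : u₀ ∈ S := ⟨hu₀, hφ₀.le⟩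
    have h1S : u₁ ∈ S := ⟨hu₀.trans hu₁.le, hφ₁.le⟩
    have hbb : BddBelow S := ⟨0, fun u hu => hu.1⟩
    have hba : BddAbove S := ⟨R, fun u hu => not_lt.1 fun h => (hφR u h).not_ge hu.2⟩
    have hA : sInf S ∈ S := hSc.csInf_mem ⟨u₀, h0S⟩ hbb
    have hB : sSup S ∈ S := hSc.csSup_mem ⟨u₀, h0S⟩ hba
    set A := sInf S
    set B := sSup S
    have hAB : A < B := (csInf_le hbb h0S).trans_lt (hu₁.trans_le (le_csSup hba h1S))
    have key := fun y : ℝ => mul_secant_nonneg hφ hg hA.1 hB.1 hAB hA.2 hB.2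
      (fun u hu hφu => ⟨csInf_le hbb ⟨hu, hφu⟩, le_csSup hba ⟨hu, hφu⟩⟩) (sq_nonneg y)
    set k := (g B - g A) / (B - A)
    set h : ℝ → ℝ := fun y => D y * (g (y ^ 2) - (g A + k * (y ^ 2 - A))) with hh
    have hh' : h = fun y => (D y * g (y ^ 2) - k * (D y * y ^ 2)) - (g A - k * A) * D y := by
      funext y; simp only [hh]; ring
    have hi : Integrable h := by
      rw [hh']; exact (hig.sub (hi2.const_mul k)).sub (hiD.const_mul _)
    have hint : ∫ y, h y = ∫ y, D y * g (y ^ 2) := by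
      have e1 := integral_sub (hig.sub (hi2.const_mul k)) (hiD.const_mul (g A - k * A))
      have e2 := integral_sub hig (hi2.const_mul k)
      simp only [Pi.sub_apply] at e1
      simp only [hh', e1, e2, integral_const_mul, h0, h2]
      ring
    have hnn : ∀ y, 0 ≤ h y := by
      intro y
      rcases lt_or_ge (y ^ 2) A with h1 | h1
      · have := (key y).1 (Or.inl h1)
        exact (mul_pos_of_neg_of_neg (hneg y this.1) this.2).le
      rcases lt_or_ge B (y ^ 2) with h3 | h3
      · have := (key y).1 (Or.inr h3)
        exact (mul_pos_of_neg_of_neg (hneg y this.1) this.2).le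
      have := (key y).2 ⟨h1, h3⟩
      refine mul_nonneg ?_ this.2
      rcases this.1.eq_or_lt with h4 | h4
      · exact (hzero y h4.symm).ge
      · exact (hpos y h4).le
    rw [← hint]
    refine lt_of_le_of_ne (integral_nonneg hnn) fun hz => ?_
    have hc : Continuous h := by
      rw [hh']
      exact ((hD.mul hgc).sub (continuous_const.mul (hD.mul (continuous_pow 2)))).sub
        (continuous_const.mul hD)
    have hz' := eq_zero_of_nonneg_of_integral_eq_zero hc hi hnn hz.symm
    obtain ⟨y, hy, -⟩ := hlarge B
    have := (key y).1 (Or.inr hy)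
    exact (mul_pos_of_neg_of_neg (hneg y this.1) this.2).ne' (congrFun hz' y)
  · push Not at hex
    exfalso
    have hnn : ∀ y, 0 ≤ (-D) y := by
      intro y
      rcases (hex _ (sq_nonneg y)).eq_or_lt with h4 | h4
      · simp [hzero y h4]
      · simpa using (hneg y h4).le
    have hz := eq_zero_of_nonneg_of_integral_eq_zero hD.neg hiD.neg hnn (by simp [integral_neg, h0])
    obtain ⟨y, -, hy⟩ := hlarge 0
    have := congrFun hz y
    simp [(hneg y (hφR _ hy)).ne] at this

theorem self_lt_sinh_mul_cosh {x : ℝ} (hx : 0 < x) : x < Real.sinh x * Real.cosh x := by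
  nlinarith [Real.self_lt_sinh_iff.2 hx, Real.one_le_cosh x]

theorem hasDerivAt_tanh (x : ℝ) : HasDerivAt Real.tanh (1 / Real.cosh x ^ 2) x := by
  have h := (Real.hasDerivAt_sinh x).div (Real.hasDerivAt_cosh x) (Real.cosh_pos x).ne'
  have e : Real.tanh = Real.sinh / Real.cosh := by
    funext y; simp [Real.tanh_eq_sinh_div_cosh]
  rw [e]
  refine h.congr_deriv ?_
  rw [← sq, ← sq, Real.cosh_sq x]
  ring

theorem hasDerivAt_log_cosh (x : ℝ) :
    HasDerivAt (fun x => Real.log (Real.cosh x)) (Real.tanh x) x := by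
  rw [Real.tanh_eq_sinh_div_cosh]
  exact (Real.hasDerivAt_cosh x).log (Real.cosh_pos x).ne'

theorem strictAntiOn_tanh_div_add :
    StrictAntiOn (fun x : ℝ => Real.tanh x / x + 1 / Real.cosh x ^ 2) (Set.Ioi 0) := by
  have hd : ∀ x ∈ Set.Ioi (0 : ℝ), HasDerivAt (fun x : ℝ => Real.tanh x / x)
      ((1 / Real.cosh x ^ 2 * x - Real.tanh x * 1) / x ^ 2) x := fun x hx =>
    (hasDerivAt_tanh x).div (hasDerivAt_id x) (ne_of_gt hx)
  have h1 : AntitoneOn (fun x : ℝ => Real.tanh x / x) (Set.Ioi 0) := by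
    refine antitoneOn_of_deriv_nonpos (convex_Ioi 0)
      (fun x hx => (hd x hx).continuousAt.continuousWithinAt)
      (fun x hx => (hd x (interior_subset hx)).differentiableAt.differentiableWithinAt)
      fun x hx => ?_
    have hx := interior_subset hx
    rw [(hd x hx).deriv]
    refine div_nonpos_of_nonpos_of_nonneg ?_ (sq_nonneg _)
    have hc := Real.cosh_pos x
    rw [Real.tanh_eq_sinh_div_cosh, sub_nonpos, mul_one, div_mul_eq_mul_div,
      div_le_div_iff₀ (by positivity) hc]
    nlinarith [self_lt_sinh_mul_cosh hx]
  intro x hx y hy hxy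
  have h2 : 1 / Real.cosh y ^ 2 < 1 / Real.cosh x ^ 2 := by
    have hc := Real.cosh_pos x
    have hx : 0 < x := hx
    have : Real.cosh x < Real.cosh y :=
      Real.cosh_lt_cosh.2 (by rwa [abs_of_pos hx, abs_of_pos (hx.trans hxy)])
    gcongr
  exact add_lt_add_of_le_of_lt (h1 hx hy hxy.le) h2

theorem continuous_tanh : Continuous Real.tanh :=
  continuous_iff_continuousAt.2 fun x => (hasDerivAt_tanh x).continuousAt

theorem strictConcaveOn_sqrt_mul_tanh_sqrt :
    StrictConcaveOn ℝ (Set.Ici 0) fun u : ℝ => √u * Real.tanh √u := by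
  have hd : ∀ u ∈ Set.Ioi (0 : ℝ), HasDerivAt (fun u : ℝ => √u * Real.tanh √u)
      ((Real.tanh √u / √u + 1 / Real.cosh √u ^ 2) / 2) u := by
    intro u hu
    have hs := (Real.hasDerivAt_sqrt (ne_of_gt hu))
    have hp : 0 < √u := Real.sqrt_pos.2 hu
    refine (hs.fun_mul
      (HasDerivAt.comp (h₂ := Real.tanh) u (hasDerivAt_tanh √u) hs)).congr_deriv ?_
    have := Real.cosh_pos √u
    rw [Function.comp_apply]
    field_simp
  refine StrictAntiOn.strictConcaveOn_of_deriv (convex_Ici 0)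
    (Real.continuous_sqrt.mul (continuous_tanh.comp Real.continuous_sqrt)).continuousOn ?_
  rw [interior_Ici]
  intro x hx y hy hxy
  rw [(hd x hx).deriv, (hd y hy).deriv]
  have := strictAntiOn_tanh_div_add (Real.sqrt_pos.2 hx) (Real.sqrt_pos.2 hy)
    (Real.sqrt_lt_sqrt (le_of_lt hx) hxy)
  dsimp only at this
  linarith

theorem concaveOn_log_cosh_sub {a b : ℝ} (hb : 0 < b) (hab : b < a) :
    ConcaveOn ℝ (Set.Ici 0) fun u : ℝ =>
      Real.log (Real.cosh (a * √u)) - Real.log (Real.cosh (b * √u)) := by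
  have hs : ∀ c : ℝ, ∀ u ∈ Set.Ioi (0 : ℝ),
      HasDerivAt (fun u : ℝ => Real.log (Real.cosh (c * √u))) (c * Real.tanh (c * √u) / √u / 2) u := by
    intro c u hu
    have hp : 0 < √u := Real.sqrt_pos.2 hu
    refine (HasDerivAt.comp (h₂ := fun x => Real.log (Real.cosh x)) u
      (hasDerivAt_log_cosh (c * √u))
      ((Real.hasDerivAt_sqrt (ne_of_gt hu)).const_mul c)).congr_deriv ?_
    ring
  have hd := fun u hu => (hs a u hu).sub (hs b u hu)
  have hcont : ∀ c : ℝ, Continuous fun u : ℝ => Real.log (Real.cosh (c * √u)) := fun c =>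
    Continuous.log (Real.continuous_cosh.comp (continuous_const.mul Real.continuous_sqrt))
      fun u => (Real.cosh_pos _).ne'
  refine AntitoneOn.concaveOn_of_deriv (convex_Ici 0) ((hcont a).sub (hcont b)).continuousOn
    (fun u hu => ?_) ?_
  · rw [interior_Ici] at hu
    exact (hd u hu).differentiableAt.differentiableWithinAt
  rw [interior_Ici]
  intro x hx y hy hxy
  refine ((hd y hy).deriv.trans_le ?_).trans_eq (hd x hx).deriv.symm
  have hx' : 0 < √x := Real.sqrt_pos.2 hx
  have hy' : 0 < √y := Real.sqrt_pos.2 hy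
  have hxy' : √x ≤ √y := Real.sqrt_le_sqrt hxy
  have hdc : ∀ s : ℝ, 0 < s → ∀ c : ℝ, HasDerivAt (fun c : ℝ => c * Real.tanh (c * s) / s)
      ((1 * Real.tanh (c * s) + c * (1 / Real.cosh (c * s) ^ 2 * (1 * s))) / s) c := fun s hs c =>
    ((hasDerivAt_id' c).fun_mul
      (HasDerivAt.comp (h₂ := Real.tanh) c (hasDerivAt_tanh (c * s)) ((hasDerivAt_id' c).mul_const s))).div_const
      s
  have hm : MonotoneOn (fun c : ℝ => c * Real.tanh (c * √x) / √x - c * Real.tanh (c * √y) / √y)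
      (Set.Ioi 0) := by
    have hdd := fun c => (hdc √x hx' c).sub (hdc √y hy' c)
    refine monotoneOn_of_deriv_nonneg (convex_Ioi 0)
      (fun c _ => (hdd c).continuousAt.continuousWithinAt)
      (fun c _ => (hdd c).differentiableAt.differentiableWithinAt) fun c hc => ?_
    have hc : 0 < c := interior_subset hc
    refine le_of_le_of_eq ?_ (hdd c).deriv.symm
    have := strictAntiOn_tanh_div_add.antitoneOn (mul_pos hc hx') (mul_pos hc hy')
      (mul_le_mul_of_nonneg_left hxy' hc.le)
    have h2 := mul_le_mul_of_nonneg_left this hc.le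
    have e : ∀ s : ℝ, 0 < s →
        (1 * Real.tanh (c * s) + c * (1 / Real.cosh (c * s) ^ 2 * (1 * s))) / s
        = c * (Real.tanh (c * s) / (c * s) + 1 / Real.cosh (c * s) ^ 2) := by
      intro s hs
      have := Real.cosh_pos (c * s)
      field_simp
    rw [e _ hx', e _ hy']
    linarith
  have := hm hb (hb.trans hab) hab.le
  dsimp only at this
  linarith


theorem gaussianPDFReal_symmetrization (m : ℝ) {v : NNReal} (hv : v ≠ 0) (y : ℝ) :
    (gaussianPDFReal m v y + gaussianPDFReal m v (-y)) / 2 =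
      (√(2 * Real.pi * v))⁻¹ * Real.exp (-m ^ 2 / (2 * v)) * Real.exp (-y ^ 2 / (2 * v)) *
        Real.cosh (m / v * y) := by
  have hv' : (v : ℝ) ≠ 0 := by exact_mod_cast hv
  have e1 : -(y - m) ^ 2 / (2 * v) = -m ^ 2 / (2 * v) + -y ^ 2 / (2 * v) + m / v * y := by
    field_simp; ring
  have e2 : -(-y - m) ^ 2 / (2 * v) = -m ^ 2 / (2 * v) + -y ^ 2 / (2 * v) + -(m / v * y) := by
    field_simp; ring
  rw [gaussianPDFReal, gaussianPDFReal, e1, e2, Real.exp_add, Real.exp_add, Real.exp_add,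
    Real.exp_add, Real.cosh_eq]
  ring

theorem integrable_and_integral_even_gaussianReal (m : ℝ) {v : NNReal} (hv : v ≠ 0) {k : ℝ → ℝ}
    (hk : ∀ y, k (-y) = k y) (hi : Integrable k (gaussianReal m v)) :
    Integrable (fun y => (gaussianPDFReal m v y + gaussianPDFReal m v (-y)) / 2 * k y) ∧
    ∫ y, (gaussianPDFReal m v y + gaussianPDFReal m v (-y)) / 2 * k y =
      ∫ y, k y ∂(gaussianReal m v) := by
  have h1 : Integrable fun y => gaussianPDFReal m v y * k y := by
    rw [gaussianReal_of_var_ne_zero m hv, integrable_withDensity_iff_integrable_smul'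
      (measurable_gaussianPDF m v) (ae_of_all _ fun _ => gaussianPDF_lt_top)] at hi
    simpa only [toReal_gaussianPDF, smul_eq_mul] using hi
  have h2 : Integrable fun y => gaussianPDFReal m v (-y) * k y := by
    simpa only [hk] using h1.comp_neg
  have e : (fun y => (gaussianPDFReal m v y + gaussianPDFReal m v (-y)) / 2 * k y) =
      fun y => (gaussianPDFReal m v y * k y + gaussianPDFReal m v (-y) * k y) / 2 := by
    funext y; ring
  have h3 : ∫ y, gaussianPDFReal m v (-y) * k y = ∫ y, gaussianPDFReal m v y * k y := by
    rw [← integral_neg_eq_self]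
    simp only [neg_neg, hk]
  refine ⟨e ▸ (h1.add h2).div_const 2, ?_⟩
  rw [e, integral_div, integral_add h1 h2, h3, integral_gaussianReal_eq_integral_smul hv]
  simp only [smul_eq_mul]
  ring

theorem integrable_sq_gaussianReal (m : ℝ) (v : NNReal) :
    Integrable (fun y => y ^ 2) (gaussianReal m v) :=
  (memLp_id_gaussianReal 2).integrable_sq

theorem integral_sq_gaussianReal (m : ℝ) (v : NNReal) :
    ∫ y, y ^ 2 ∂(gaussianReal m v) = m ^ 2 + v := by
  have h := variance_eq_sub (memLp_id_gaussianReal (μ := m) (v := v) 2)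
  rw [variance_id_gaussianReal] at h
  simp only [id_eq, Pi.pow_apply, integral_id_gaussianReal] at h
  linarith

theorem integrable_mul_tanh_gaussianReal (m : ℝ) (v : NNReal) :
    Integrable (fun y => y * Real.tanh y) (gaussianReal m v) := by
  refine ((memLp_id_gaussianReal 1).integrable (by simp)).mono
    (continuous_id.mul continuous_tanh).aestronglyMeasurable (ae_of_all _ fun y => ?_)
  rw [norm_mul]
  exact mul_le_of_le_one_right (norm_nonneg _) (Real.abs_tanh_lt_one y).le

theorem sqrt_sq_mul_tanh (y : ℝ) : √(y ^ 2) * Real.tanh √(y ^ 2) = y * Real.tanh y := by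
  rw [Real.sqrt_sq_eq_abs]
  rcases abs_choice y with h | h <;> simp [h]

theorem log_cosh_le {x : ℝ} (hx : 0 ≤ x) : Real.log (Real.cosh x) ≤ x := by
  rw [Real.log_le_iff_le_exp (Real.cosh_pos x), Real.cosh_eq]
  linarith [Real.exp_le_exp.2 (show -x ≤ x by linarith)]

theorem integral_mul_tanh_gaussianReal_lt {m₁ m₂ : ℝ} {v₁ v₂ : NNReal} (hm₁ : 0 < m₁)
    (hm₂ : 0 < m₂) (hv₁ : 0 < v₁) (hv : v₁ < v₂) (hmom : m₁ ^ 2 + (v₁ : ℝ) = m₂ ^ 2 + v₂) :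
    ∫ y, y * Real.tanh y ∂(gaussianReal m₂ v₂) < ∫ y, y * Real.tanh y ∂(gaussianReal m₁ v₁) := by
  have hv₂ : 0 < v₂ := hv₁.trans hv
  have hr₁ : (0 : ℝ) < v₁ := hv₁
  have hr₂ : (0 : ℝ) < v₂ := hv₂
  have hr : (v₁ : ℝ) < v₂ := hv
  have hm : m₂ < m₁ := lt_of_pow_lt_pow_left₀ 2 hm₁.le (by linarith)
  set p : ℝ → NNReal → ℝ → ℝ := fun m v y =>
    (gaussianPDFReal m v y + gaussianPDFReal m v (-y)) / 2 with hp
  set C : ℝ → NNReal → ℝ := fun m v =>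
    (√(2 * Real.pi * v))⁻¹ * Real.exp (-m ^ 2 / (2 * v)) with hC
  have hpe : ∀ m : ℝ, ∀ v : NNReal, 0 < v → ∀ y, p m v y =
      C m v * Real.exp (-y ^ 2 / (2 * v)) * Real.cosh (m / v * y) := fun m v hv y =>
    gaussianPDFReal_symmetrization m hv.ne' y
  have hCpos : ∀ m : ℝ, ∀ v : NNReal, 0 < v → 0 < C m v := by
    intro m v hv
    have : (0 : ℝ) < v := hv
    positivity
  have hppos : ∀ m : ℝ, ∀ v : NNReal, 0 < v → ∀ y, 0 < p m v y := by
    intro m v hv y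
    rw [hpe m v hv]
    exact mul_pos (mul_pos (hCpos m v hv) (Real.exp_pos _)) (Real.cosh_pos _)
  have hlog : ∀ m : ℝ, ∀ v : NNReal, 0 < v → ∀ y, Real.log (p m v y) =
      Real.log (C m v) - y ^ 2 / (2 * v) + Real.log (Real.cosh (m / v * √(y ^ 2))) := by
    intro m v hv y
    have hc : Real.cosh (m / v * √(y ^ 2)) = Real.cosh (m / v * y) := by
      rw [Real.sqrt_sq_eq_abs]
      rcases abs_choice y with h | h <;> simp [h]
    rw [hpe m v hv, hc, Real.log_mul (mul_pos (hCpos m v hv) (Real.exp_pos _)).ne'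
      (Real.cosh_pos _).ne', Real.log_mul (hCpos m v hv).ne' (Real.exp_pos _).ne', Real.log_exp]
    ring
  have hpc : ∀ m : ℝ, ∀ v : NNReal, 0 < v → Continuous (p m v) := by
    intro m v hv
    rw [funext (hpe m v hv)]
    fun_prop
  set a := m₁ / v₁ with ha
  set b := m₂ / v₂ with hb
  have hbpos : 0 < b := div_pos hm₂ hr₂
  have hab : b < a := div_lt_div₀ hm hr.le hm₁.le hr₁
  set c := 1 / (2 * (v₁ : ℝ)) - 1 / (2 * v₂) with hc
  have hcpos : 0 < c := sub_pos.2 (one_div_lt_one_div_of_lt (by positivity) (by linarith))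
  set K := Real.log (C m₁ v₁) - Real.log (C m₂ v₂) with hK
  set φ : ℝ → ℝ := fun u => (Real.log (Real.cosh (a * √u)) - Real.log (Real.cosh (b * √u))) +
    (K - c * u) with hφ
  have hφlog : ∀ y, φ (y ^ 2) = Real.log (p m₁ v₁ y) - Real.log (p m₂ v₂ y) := by
    intro y
    rw [hlog _ _ hv₁, hlog _ _ hv₂]
    simp only [hφ, hK, hc]
    ring
  have hφconc : ConcaveOn ℝ (Set.Ici 0) φ := by
    refine (concaveOn_log_cosh_sub hbpos hab).add ⟨convex_Ici 0, fun x _ y _ s t _ _ hst => ?_⟩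
    simp only [smul_eq_mul]
    linear_combination K * hst
  have hφcont : Continuous φ := by
    have h := fun d : ℝ => Continuous.log (f := fun u : ℝ => Real.cosh (d * √u)) (by fun_prop)
      fun u => (Real.cosh_pos _).ne'
    exact ((h a).sub (h b)).add (by fun_prop)
  have hφneg : ∀ u, ((a + |K|) / c + 1) ^ 2 < u → φ u < 0 := by
    intro u hu
    have hapos := hbpos.trans hab
    have h1 : (a + |K|) / c + 1 < √u := Real.lt_sqrt_of_sq_lt hu
    have hq : 0 ≤ (a + |K|) / c := by positivity
    have hu0 : u = √u * √u := (Real.mul_self_sqrt ((sq_nonneg _).trans hu.le)).symm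
    have h2 : a + |K| < c * √u := by
      rw [← div_lt_iff₀' hcpos]; linarith
    have h3 := log_cosh_le (mul_nonneg hapos.le (Real.sqrt_nonneg u))
    have h4 := Real.log_nonneg (Real.one_le_cosh (b * √u))
    have h5 : (a + |K|) * √u < c * u := by
      calc (a + |K|) * √u < c * √u * √u := mul_lt_mul_of_pos_right h2 (by linarith)
        _ = c * u := by rw [mul_assoc, ← hu0]
    have h6 : |K| ≤ |K| * √u := le_mul_of_one_le_right (abs_nonneg K) (by linarith)
    have h7 := le_abs_self K
    simp only [hφ]
    linarith
  have hmass : ∀ m : ℝ, ∀ v : NNReal, 0 < v →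
      Integrable (fun y => p m v y) ∧ ∫ y, p m v y = 1 := by
    intro m v hv
    simpa using integrable_and_integral_even_gaussianReal m hv.ne' (k := fun _ => 1)
      (fun _ => rfl) (integrable_const 1)
  have hsq := fun (m : ℝ) (v : NNReal) (hv : 0 < v) =>
    integrable_and_integral_even_gaussianReal m hv.ne' (k := fun y => y ^ 2)
      (fun _ => by ring) (integrable_sq_gaussianReal m v)
  have htanh := fun (m : ℝ) (v : NNReal) (hv : 0 < v) =>
    integrable_and_integral_even_gaussianReal m hv.ne' (k := fun y => y * Real.tanh y)
      (fun _ => by simp) (integrable_mul_tanh_gaussianReal m v)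
  have hi2 := integral_sub (hsq m₁ v₁ hv₁).1 (hsq m₂ v₂ hv₂).1
  have hit := integral_sub (htanh m₁ v₁ hv₁).1 (htanh m₂ v₂ hv₂).1
  rw [(hsq m₁ v₁ hv₁).2, (hsq m₂ v₂ hv₂).2, integral_sq_gaussianReal, integral_sq_gaussianReal,
    hmom, sub_self] at hi2
  rw [(htanh m₁ v₁ hv₁).2, (htanh m₂ v₂ hv₂).2] at hit
  rw [← sub_pos, ← hit]
  simp only [← sub_mul] at hi2 ⊢
  have := integral_pos_of_sign (D := fun y => p m₁ v₁ y - p m₂ v₂ y) (φ := φ)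
    (g := fun u => √u * Real.tanh √u) (R := ((a + |K|) / c + 1) ^ 2)
    ((hpc _ _ hv₁).sub (hpc _ _ hv₂)) hφconc hφcont.continuousOn (sq_nonneg _) hφneg
    (fun y h => by
      rw [hφlog, sub_pos] at h
      exact sub_pos.2 ((Real.log_lt_log_iff (hppos _ _ hv₂ y) (hppos _ _ hv₁ y)).1 h))
    (fun y h => by
      rw [hφlog, sub_neg] at h
      exact sub_neg.2 ((Real.log_lt_log_iff (hppos _ _ hv₁ y) (hppos _ _ hv₂ y)).1 h))
    (fun y h => by
      rw [hφlog, sub_eq_zero] at h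
      exact sub_eq_zero.2 (Real.log_injOn_pos (hppos _ _ hv₁ y) (hppos _ _ hv₂ y) h))
    strictConcaveOn_sqrt_mul_tanh_sqrt
    (by simpa only [sqrt_sq_mul_tanh] using continuous_id'.fun_mul continuous_tanh)
    ((hmass _ _ hv₁).1.sub (hmass _ _ hv₂).1)
    (by simp only [sub_mul]; exact (hsq _ _ hv₁).1.sub (hsq _ _ hv₂).1)
    (by simp only [sqrt_sq_mul_tanh, sub_mul]; exact (htanh _ _ hv₁).1.sub (htanh _ _ hv₂).1)
    (by rw [integral_sub (hmass _ _ hv₁).1 (hmass _ _ hv₂).1, (hmass _ _ hv₁).2,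
      (hmass _ _ hv₂).2, sub_self])
    hi2
  simpa only [sqrt_sq_mul_tanh] using this

/-- Two well-separated Gaussians `N(mᵢ, σᵢ²)` with matching second moments
`m₁² + σ₁² = m₂² + σ₂²` and matching moments `E[Y·tanh(Y)]` must coincide. -/
theorem stmt10 (m₁ m₂ : ℝ) (σ₁ σ₂ : NNReal)
    (hm₁ : 0 < m₁) (hm₂ : 0 < m₂) (hσ₁ : 0 < σ₁) (hσ₂ : 0 < σ₂)
    (hsep₁ : 2 * (σ₁ : ℝ) ^ 2 + (σ₁ : ℝ) ≤ m₁)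
    (hsep₂ : 2 * (σ₂ : ℝ) ^ 2 + (σ₂ : ℝ) ≤ m₂)
    (hmom : m₁ ^ 2 + (σ₁ : ℝ) ^ 2 = m₂ ^ 2 + (σ₂ : ℝ) ^ 2)
    (htanh : (∫ y, y * Real.tanh y ∂(gaussianReal m₁ (σ₁ ^ 2))) =
      ∫ y, y * Real.tanh y ∂(gaussianReal m₂ (σ₂ ^ 2))) :
    m₁ = m₂ ∧ σ₁ = σ₂ := by
  rcases lt_trichotomy σ₁ σ₂ with h | h | h
  · exact absurd htanh (integral_mul_tanh_gaussianReal_lt hm₁ hm₂ (pow_pos hσ₁ 2)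
      (pow_lt_pow_left₀ h zero_le two_ne_zero) (by push_cast; exact hmom)).ne'
  · subst h
    exact ⟨(pow_left_inj₀ hm₁.le hm₂.le two_ne_zero).1 (add_right_cancel hmom), rfl⟩
  · exact absurd htanh (integral_mul_tanh_gaussianReal_lt hm₂ hm₁ (pow_pos hσ₂ 2)
      (pow_lt_pow_left₀ h zero_le two_ne_zero) (by push_cast; exact hmom.symm)).ne
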